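/- arXiv:1609.04676 — 3 statements merged into one kernel-verified Lean document; each statement's English description precedes it below -/
import Mathlib

section
/- Let K be a field of characteristic zero, A = K[x₁,…,xₙ], f ∈ A, R = A[t], h = t − f, and C = R[h⁻¹]/R the cokernel of R → Localization.Away h. Let ∂_{x_i} and ∂_t be the endomorphisms of C induced by the unique derivations of Localization.Away h extending the partial derivatives of R, and let 𝒜_Y ⊆ Module.End K C be the K-subalgebra generated by multiplication by x₁,…,xₙ, multiplication by t, and ∂_{x_1},…,∂_{x_n}, ∂_t (modeling D_Y). Then the annihilator {P ∈ 𝒜_Y : P(δ₀) = 0} of the class δ₀ of 1/(t−f) equals the left ideal of 𝒜_Y generated by: multiplication by (t − f), and the operators ∂_{x_i} + M_{f_i}∘∂_t for i = 1,…,n, where M_a denotes multiplication by a and f_i = ∂f/∂x_i. -/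
open Polynomial

set_option synthInstance.maxHeartbeats 4000000
set_option maxHeartbeats 4000000
set_option maxSynthPendingDepth 3

noncomputable section

namespace Stmt17

variable (K : Type) [Field K] (n : ℕ)

/-- `R = A[t]` where `A = K[x₁,…,xₙ]`. -/
abbrev R := Polynomial (MvPolynomial (Fin n) K)

/-- `h = t − f ∈ R`. -/
abbrev h (f : MvPolynomial (Fin n) K) : R K n := X - C f

/-- `R[h⁻¹]`. -/
abbrev L (f : MvPolynomial (Fin n) K) := Localization.Away (h K n f)

/-- `C = R[h⁻¹]/R`, realizing `B_{Z|Y} = H¹_Z(K[x,t])`, `Z = {t = f}`. -/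
abbrev Coh (f : MvPolynomial (Fin n) K) :=
  L K n f ⧸ LinearMap.range (Algebra.linearMap (R K n) (L K n f))

/-- Multiplication by `r ∈ R` as a `K`-linear endomorphism of `C`. -/
def mulOp (f : MvPolynomial (Fin n) K) (r : R K n) : Module.End K (Coh K n f) :=
  (LinearMap.lsmul (R K n) (Coh K n f) r).restrictScalars K

/-- The element `1/(t−f)` of `R[h⁻¹]`. -/
def deltaL (f : MvPolynomial (Fin n) K) : L K n f :=
  Localization.mk 1 ⟨h K n f, 1, pow_one _⟩

section Abstract

variable {K n}
variable {E : Type} [Ring E] [Algebra K E]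

/-- normal form operator `∑ a_m ∂_t^m`. -/
def T (μ : R K n →ₐ[K] E) (dt : E) (p : R K n) : E := p.sum fun m a => μ (C a) * dt ^ m

lemma T_add (μ : R K n →ₐ[K] E) (dt : E) (p q : R K n) :
    T μ dt (p + q) = T μ dt p + T μ dt q := by
  unfold T
  exact Polynomial.sum_add_index p q _ (by simp) (by intro m a b; simp [add_mul])

lemma T_monomial (μ : R K n →ₐ[K] E) (dt : E) (m : ℕ) (a : MvPolynomial (Fin n) K) :
    T μ dt (monomial m a) = μ (C a) * dt ^ m := by
  unfold T
  exact Polynomial.sum_monomial_index a _ (by simp)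

/-- being equal to a normal form modulo the left ideal. -/
def Good (μ : R K n →ₐ[K] E) (dx : Fin n → E) (dt : E) (f : MvPolynomial (Fin n) K)
    (𝒜 : Subalgebra K E) (P : E) : Prop :=
  ∃ (Q0 : E) (Q : Fin n → E) (p : R K n), Q0 ∈ 𝒜 ∧ (∀ i, Q i ∈ 𝒜) ∧
    P = Q0 * μ (h K n f) + ∑ i : Fin n, Q i * (dx i + μ (C (MvPolynomial.pderiv i f)) * dt)
      + T μ dt p

variable {μ : R K n →ₐ[K] E} {dx : Fin n → E} {dt : E} {f : MvPolynomial (Fin n) K}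
    {𝒜 : Subalgebra K E}

lemma Good.add {P P' : E} (hP : Good μ dx dt f 𝒜 P) (hP' : Good μ dx dt f 𝒜 P') :
    Good μ dx dt f 𝒜 (P + P') := by
  obtain ⟨Q0, Q, p, h0, hQ, rfl⟩ := hP
  obtain ⟨Q0', Q', p', h0', hQ', rfl⟩ := hP'
  refine ⟨Q0 + Q0', fun i => Q i + Q' i, p + p', add_mem h0 h0',
    fun i => add_mem (hQ i) (hQ' i), ?_⟩
  simp only [T_add, add_mul, Finset.sum_add_distrib]
  abel

lemma good_T (p : R K n) : Good μ dx dt f 𝒜 (T μ dt p) :=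
  ⟨0, fun _ => 0, p, zero_mem _, fun _ => zero_mem _, by simp⟩

lemma good_mono (m : ℕ) (a : MvPolynomial (Fin n) K) :
    Good μ dx dt f 𝒜 (μ (C a) * dt ^ m) := by
  rw [← T_monomial]; exact good_T _

lemma good_left {Q0 : E} (h0 : Q0 ∈ 𝒜) : Good μ dx dt f 𝒜 (Q0 * μ (h K n f)) :=
  ⟨Q0, fun _ => 0, 0, h0, fun _ => zero_mem _, by simp [T]⟩

lemma good_theta {Q0 : E} (h0 : Q0 ∈ 𝒜) (i : Fin n) :
    Good μ dx dt f 𝒜 (Q0 * (dx i + μ (C (MvPolynomial.pderiv i f)) * dt)) := by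
  classical
  refine ⟨0, fun j => if j = i then Q0 else 0, 0, zero_mem _, fun j => ?_, ?_⟩
  · dsimp only
    split_ifs
    · exact h0
    · exact zero_mem _
  · simp [T, ite_mul]

lemma good_mul {g : E} (hg : g ∈ 𝒜)
    (H : ∀ (m : ℕ) (a : MvPolynomial (Fin n) K), Good μ dx dt f 𝒜 (g * (μ (C a) * dt ^ m)))
    {P : E} (hP : Good μ dx dt f 𝒜 P) : Good μ dx dt f 𝒜 (g * P) := by
  obtain ⟨Q0, Q, p, h0, hQ, rfl⟩ := hP
  rw [mul_add]
  refine Good.add ?_ ?_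
  · refine ⟨g * Q0, fun i => g * Q i, 0, mul_mem hg h0, fun i => mul_mem hg (hQ i), ?_⟩
    simp [T, mul_add, Finset.mul_sum, mul_assoc]
  · induction p using Polynomial.induction_on' with
    | add p q hp hq => rw [T_add, mul_add]; exact hp.add hq
    | monomial m a => rw [T_monomial]; exact H m a

lemma pow_comm_X (h2 : dt * μ X = μ X * dt + 1) (m : ℕ) :
    μ X * dt ^ m = dt ^ m * μ X - (m : E) * dt ^ (m - 1) := by
  induction m with
  | zero => simp
  | succ k ih =>
    have e : μ X * dt = dt * μ X - 1 := by rw [h2]; abel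
    have hk : (k : E) * dt ^ (k - 1) * dt = (k : E) * dt ^ k := by
      cases k with
      | zero => simp
      | succ j => simp [pow_succ, mul_assoc]
    rw [pow_succ, ← mul_assoc, ih, sub_mul, hk, mul_assoc, e, mul_sub, mul_one, mul_assoc]
    push_cast
    simp only [add_tsub_cancel_right, add_mul, one_mul]
    abel

theorem good_all
    (h1 : ∀ a, Commute dt (μ (C a)))
    (h2 : dt * μ X = μ X * dt + 1)
    (h3 : ∀ i a, dx i * μ (C a) = μ (C a) * dx i + μ (C (MvPolynomial.pderiv i a)))
    (h4 : ∀ i, Commute (dx i) dt)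
    (hA : 𝒜 = Algebra.adjoin K
        ((((Set.range fun i : Fin n => μ (C (MvPolynomial.X i))) ∪
            {μ X}) ∪ Set.range dx) ∪ {dt})) :
    ∀ P ∈ 𝒜, Good μ dx dt f 𝒜 P := by
  have hx : ∀ i, μ (C (MvPolynomial.X i)) ∈ 𝒜 := fun i => by
    rw [hA]; exact Algebra.subset_adjoin (by simp)
  have ht : μ X ∈ 𝒜 := by
    rw [hA]; exact Algebra.subset_adjoin (by simp)
  have hdx : ∀ i, dx i ∈ 𝒜 := fun i => by
    rw [hA]; exact Algebra.subset_adjoin (by simp)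
  have hdt : dt ∈ 𝒜 := by
    rw [hA]; exact Algebra.subset_adjoin (by simp)
  have hK : ∀ c : K, μ (C (MvPolynomial.C c)) = algebraMap K E c := fun c => by
    have := μ.commutes c
    rw [← this]; rfl
  have hC : ∀ a, μ (C a) ∈ 𝒜 := fun a => by
    induction a using MvPolynomial.induction_on with
    | C c => rw [hK]; exact 𝒜.algebraMap_mem c
    | add p q hp hq => rw [C_add, map_add]; exact add_mem hp hq
    | mul_X p i hp => rw [C_mul, map_mul]; exact mul_mem hp (hx i)
  have hCC : ∀ (b : MvPolynomial (Fin n) K) (m : ℕ) (a : MvPolynomial (Fin n) K),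
      Good μ dx dt f 𝒜 (μ (C b) * (μ (C a) * dt ^ m)) := fun b m a => by
    rw [← mul_assoc, ← map_mul, ← C_mul]; exact good_mono _ _
  have key : ∀ g ∈ 𝒜, ∀ P, Good μ dx dt f 𝒜 P → Good μ dx dt f 𝒜 (g * P) := by
    intro g hg
    have hg' := hg
    rw [hA] at hg'
    induction hg' using Algebra.adjoin_induction with
    | mem g hgm =>
      intro P hP
      refine good_mul hg ?_ hP
      intro m a
      rcases hgm with ((⟨i, rfl⟩ | hgm) | ⟨i, rfl⟩) | hgm
      · exact hCC _ _ _
      · rw [Set.mem_singleton_iff] at hgm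
        subst hgm
        have e : μ X * (μ (C a) * dt ^ m) = (μ (C a) * dt ^ m) * μ (h K n f)
            + μ (C (a * f)) * dt ^ m + μ (C (-(m : MvPolynomial (Fin n) K) * a)) * dt ^ (m - 1) := by
          have c1 : μ X * μ (C a) = μ (C a) * μ X := by
            rw [← map_mul, ← map_mul, mul_comm]
          have c2 : dt ^ m * μ (C f) = μ (C f) * dt ^ m := ((h1 f).pow_left m).eq
          rw [← mul_assoc, c1, mul_assoc, pow_comm_X h2]
          simp only [map_sub, map_mul, map_neg, map_natCast, mul_sub, mul_assoc, c2, neg_mul]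
          rw [← mul_assoc (μ (C a)) (m : E), ← Nat.cast_commute m (μ (C a)), mul_assoc]
          abel
        rw [e]
        exact ((good_left (mul_mem (hC a) (pow_mem hdt m))).add (good_mono _ _)).add (good_mono _ _)
      · have e : dx i * (μ (C a) * dt ^ m) =
            (μ (C a) * dt ^ m) * (dx i + μ (C (MvPolynomial.pderiv i f)) * dt)
            + μ (C (-(a * MvPolynomial.pderiv i f))) * dt ^ (m + 1)
            + μ (C (MvPolynomial.pderiv i a)) * dt ^ m := by
          have c2 : dt ^ m * μ (C (MvPolynomial.pderiv i f))
            = μ (C (MvPolynomial.pderiv i f)) * dt ^ m := ((h1 _).pow_left m).eq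
          have c3 : dx i * dt ^ m = dt ^ m * dx i := ((h4 i).pow_right m).eq
          rw [← mul_assoc, h3, add_mul, mul_assoc, c3]
          simp only [mul_add, C_neg, C_mul, map_neg, map_mul, neg_mul, pow_succ, mul_assoc]
          rw [← mul_assoc (dt ^ m), c2, mul_assoc]
          abel
        rw [e]
        exact ((good_theta (mul_mem (hC a) (pow_mem hdt m)) i).add (good_mono _ _)).add
          (good_mono _ _)
      · rw [Set.mem_singleton_iff] at hgm
        subst hgm
        rw [← mul_assoc, (h1 a).eq, mul_assoc, ← pow_succ']
        exact good_mono _ _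
    | algebraMap c =>
      intro P hP
      refine good_mul hg ?_ hP
      intro m a
      rw [← hK]; exact hCC _ _ _
    | add x y hx hy ihx ihy =>
      intro P hP
      rw [add_mul]
      rw [← hA] at hx hy
      exact (ihx hx P hP).add (ihy hy P hP)
    | mul x y hx hy ihx ihy =>
      intro P hP
      rw [mul_assoc]
      rw [← hA] at hx hy
      exact ihx hx _ (ihy hy P hP)
  intro P hP
  have := key P hP 1 (by simpa using good_mono (μ := μ) (dt := dt) (dx := dx) (f := f) (𝒜 := 𝒜) 0 1)
  simpa using this

end Abstract

section Concrete

variable {K n}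
variable {f : MvPolynomial (Fin n) K}

/-- multiplication as an algebra hom -/
def muHom (f : MvPolynomial (Fin n) K) : R K n →ₐ[K] Module.End K (Coh K n f) :=
  Algebra.lsmul K K (Coh K n f)

lemma muHom_eq (r : R K n) : muHom f r = mulOp K n f r := rfl

lemma mulOp_mk (r : R K n) (q : L K n f) :
    mulOp K n f r (Submodule.Quotient.mk q) =
      Submodule.Quotient.mk (algebraMap (R K n) (L K n f) r * q) := by
  rw [← Algebra.smul_def]; rfl

lemma h_mul_delta : algebraMap (R K n) (L K n f) (h K n f) * deltaL K n f = 1 := by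
  unfold deltaL
  rw [Localization.mk_eq_mk', IsLocalization.mul_mk'_eq_mk'_of_mul, mul_one]
  exact IsLocalization.mk'_self (L K n f) _

lemma D_delta (D : Derivation K (L K n f) (L K n f)) :
    D (deltaL K n f) =
      - (D (algebraMap (R K n) (L K n f) (h K n f)) * deltaL K n f ^ 2) := by
  have e := congrArg D (h_mul_delta (f := f))
  rw [Derivation.leibniz, Derivation.map_one_eq_zero] at e
  simp only [smul_eq_mul] at e
  have e1 := h_mul_delta (f := f)
  linear_combination (deltaL K n f) * e - D (deltaL K n f) * e1

lemma D_eq_zero (D : Derivation K (L K n f) (L K n f))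
    (hD : ∀ r, D (algebraMap (R K n) (L K n f) r) = 0) (q : L K n f) : D q = 0 := by
  obtain ⟨k, r, e⟩ := IsLocalization.Away.surj (h K n f) q
  have e1 := congrArg D e
  rw [hD, Derivation.leibniz, ← map_pow, hD, smul_zero, zero_add, smul_eq_mul, map_pow] at e1
  have e2 : (algebraMap (R K n) (L K n f) (h K n f)) ^ k * deltaL K n f ^ k = 1 := by
    rw [← mul_pow, h_mul_delta, one_pow]
  linear_combination deltaL K n f ^ k * e1 - D q * e2

lemma alg_inj : Function.Injective (algebraMap (R K n) (L K n f)) := by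
  apply IsLocalization.injective (M := Submonoid.powers (h K n f))
  apply powers_le_nonZeroDivisors_of_noZeroDivisors
  exact X_sub_C_ne_zero f

lemma T_zero [CharZero K] (Dt : Derivation K (L K n f) (L K n f))
    (hDt : ∀ r : R K n,
      Dt (algebraMap (R K n) (L K n f) r) =
        algebraMap (R K n) (L K n f) (derivative r))
    (dt : Module.End K (Coh K n f))
    (hdt : ∀ q : L K n f,
      dt (Submodule.Quotient.mk q) = Submodule.Quotient.mk (Dt q))
    (p : R K n)
    (hp : T (muHom f) dt p (Submodule.Quotient.mk (deltaL K n f)) = 0) : p = 0 := by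
  have hd : Dt (deltaL K n f) = - deltaL K n f ^ 2 := by
    rw [D_delta, hDt]; simp
  have hpow : ∀ m : ℕ, (dt ^ m) (Submodule.Quotient.mk (deltaL K n f)) =
      Submodule.Quotient.mk
        (algebraMap (R K n) (L K n f) ((-1) ^ m * (m.factorial : R K n)) * deltaL K n f ^ (m + 1)) := by
    intro m
    induction m with
    | zero => simp
    | succ k ih =>
      rw [pow_succ', Module.End.mul_apply, ih, hdt]
      congr 1
      rw [Derivation.leibniz, hDt, Derivation.leibniz_pow, hd]
      have : derivative ((-1) ^ k * (k.factorial : R K n)) = 0 := by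
        have : ((-1) ^ k * (k.factorial : R K n)) = C ((-1) ^ k * (k.factorial : MvPolynomial (Fin n) K)) := by
          simp
        rw [this, derivative_C]
      rw [this]
      simp only [map_zero, smul_zero, add_zero, smul_eq_mul, nsmul_eq_mul, map_mul, map_pow, map_neg,
        map_one, map_natCast, Nat.factorial_succ, Nat.add_sub_cancel]
      push_cast
      ring
  set c : ℕ → MvPolynomial (Fin n) K := fun m =>
    p.coeff m * ((-1) ^ m * (m.factorial : MvPolynomial (Fin n) K)) with hc
  set N := p.natDegree with hN
  have hsum : T (muHom f) dt p (Submodule.Quotient.mk (deltaL K n f)) =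
      Submodule.Quotient.mk (∑ m ∈ Finset.range (N + 1),
        algebraMap (R K n) (L K n f) (C (c m)) * deltaL K n f ^ (m + 1)) := by
    unfold T
    rw [Polynomial.sum_over_range p (by simp), LinearMap.sum_apply]
    refine Eq.trans ?_ (map_sum (Submodule.mkQ _) _ _).symm
    refine Finset.sum_congr rfl fun m _ => ?_
    rw [Module.End.mul_apply, hpow, muHom_eq, mulOp_mk, Submodule.mkQ_apply]
    congr 1
    simp only [hc, map_mul, map_pow, map_neg, map_one, map_natCast]
    ring
  rw [hsum, Submodule.Quotient.mk_eq_zero] at hp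
  obtain ⟨r, hr⟩ := hp
  rw [Algebra.linearMap_apply] at hr
  have hR : h K n f ^ (N + 1) * r = ∑ m ∈ Finset.range (N + 1), C (c m) * h K n f ^ (N - m) := by
    apply alg_inj (f := f)
    rw [map_mul, map_pow, hr, map_sum, Finset.mul_sum]
    refine Finset.sum_congr rfl fun m hm => ?_
    have hm' : N + 1 = (N - m) + (m + 1) := by
      have := Finset.mem_range.1 hm
      omega
    have e2 : (algebraMap (R K n) (L K n f) (h K n f)) ^ (m+1) * deltaL K n f ^ (m+1) = 1 := by
      rw [← mul_pow, h_mul_delta, one_pow]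
    rw [map_mul _ (C (c m)), map_pow, show (algebraMap (R K n) (L K n f) (h K n f)) ^ (N + 1) = _ from congrArg _ hm', pow_add]
    linear_combination (algebraMap (R K n) (L K n f) (h K n f)) ^ (N - m) *
      algebraMap (R K n) (L K n f) (C (c m)) * e2
  have hE := congrArg (Polynomial.eval f) hR
  rw [Finset.sum_range_succ, eval_add, eval_finsetSum] at hE
  rw [Finset.sum_eq_zero] at hE
  · simp [hc, Nat.factorial_ne_zero] at hE
    exact leadingCoeff_eq_zero.1 hE
  · intro m hm
    have := Finset.mem_range.1 hm
    have h0 : N - m ≠ 0 := by omega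
    simp [h0]

end Concrete

/-- let `𝒜_Y ⊆ End_K(C)` be the `K`-subalgebra generated by multiplication
by `x₁,…,xₙ` and `t` and by the induced derivations `∂_{x_1},…,∂_{x_n},∂_t` (modeling
`D_Y`). The annihilator in `𝒜_Y` of the class `δ₀` of `1/(t−f)` equals the left ideal of
`𝒜_Y` generated by multiplication by `t − f` and the operators `∂_{x_i} + M_{f_i}∘∂_t`,
`i = 1,…,n`. -/
theorem stmt17 [CharZero K] (hn : 1 ≤ n) (f : MvPolynomial (Fin n) K)
    (Dx : Fin n → Derivation K (L K n f) (L K n f))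
    (hDx : ∀ i (r : R K n),
      Dx i (algebraMap (R K n) (L K n f) r) =
        algebraMap (R K n) (L K n f)
          (r.sum fun m a => C (MvPolynomial.pderiv i a) * X ^ m))
    (Dt : Derivation K (L K n f) (L K n f))
    (hDt : ∀ r : R K n,
      Dt (algebraMap (R K n) (L K n f) r) =
        algebraMap (R K n) (L K n f) (derivative r))
    (dx : Fin n → Module.End K (Coh K n f))
    (hdx : ∀ i (q : L K n f),
      dx i (Submodule.Quotient.mk q) = Submodule.Quotient.mk (Dx i q))
    (dt : Module.End K (Coh K n f))
    (hdt : ∀ q : L K n f,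
      dt (Submodule.Quotient.mk q) = Submodule.Quotient.mk (Dt q)) :
    ∀ 𝒜 : Subalgebra K (Module.End K (Coh K n f)),
      𝒜 = Algebra.adjoin K
        ((((Set.range fun i : Fin n => mulOp K n f (C (MvPolynomial.X i))) ∪
            {mulOp K n f X}) ∪ Set.range dx) ∪ {dt}) →
      ∀ P ∈ 𝒜,
        (P (Submodule.Quotient.mk (deltaL K n f)) = 0 ↔
          ∃ (Q0 : Module.End K (Coh K n f)) (Q : Fin n → Module.End K (Coh K n f)),
            Q0 ∈ 𝒜 ∧ (∀ i, Q i ∈ 𝒜) ∧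
            P = Q0 * mulOp K n f (h K n f) +
              ∑ i : Fin n,
                Q i * (dx i + mulOp K n f (C (MvPolynomial.pderiv i f)) * dt)) := by
  intro 𝒜 hA P hP
  have hpd : ∀ i (a : MvPolynomial (Fin n) K), Dx i (algebraMap (R K n) (L K n f) (C a)) =
      algebraMap (R K n) (L K n f) (C (MvPolynomial.pderiv i a)) := fun i a => by
    rw [hDx, Polynomial.sum_C_index (by simp)]; simp
  have hX : ∀ i, Dx i (algebraMap (R K n) (L K n f) X) = 0 := fun i => by
    rw [hDx, Polynomial.sum_X_index (by simp)]; simp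
  have hh : ∀ i, Dx i (algebraMap (R K n) (L K n f) (h K n f)) =
      - algebraMap (R K n) (L K n f) (C (MvPolynomial.pderiv i f)) := fun i => by
    rw [map_sub, map_sub, hX, hpd, zero_sub]
  have hht : Dt (algebraMap (R K n) (L K n f) (h K n f)) = 1 := by
    rw [hDt]; simp
  have h1 : ∀ a, Commute dt (muHom f (C a)) := by
    intro a
    refine LinearMap.ext fun q => ?_
    obtain ⟨q, rfl⟩ := Submodule.Quotient.mk_surjective _ q
    rw [Module.End.mul_apply, Module.End.mul_apply, muHom_eq, mulOp_mk, hdt, hdt, mulOp_mk,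
      Derivation.leibniz, hDt, derivative_C, map_zero, smul_zero, add_zero, smul_eq_mul]
  have h2 : dt * muHom f X = muHom f X * dt + 1 := by
    refine LinearMap.ext fun q => ?_
    obtain ⟨q, rfl⟩ := Submodule.Quotient.mk_surjective _ q
    rw [LinearMap.add_apply, Module.End.mul_apply, Module.End.mul_apply, muHom_eq, mulOp_mk, hdt,
      hdt, mulOp_mk, Derivation.leibniz, hDt, derivative_X, map_one, smul_eq_mul, smul_eq_mul,
      mul_one, Module.End.one_apply, Submodule.Quotient.mk_add]
  have h3 : ∀ i a, dx i * muHom f (C a) =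
      muHom f (C a) * dx i + muHom f (C (MvPolynomial.pderiv i a)) := by
    intro i a
    refine LinearMap.ext fun q => ?_
    obtain ⟨q, rfl⟩ := Submodule.Quotient.mk_surjective _ q
    rw [LinearMap.add_apply, Module.End.mul_apply, Module.End.mul_apply, muHom_eq, muHom_eq,
      mulOp_mk, mulOp_mk, hdx, hdx, mulOp_mk, Derivation.leibniz, hpd, smul_eq_mul, smul_eq_mul,
      Submodule.Quotient.mk_add, mul_comm q]
  have hbr : ∀ i q, Dx i (Dt q) = Dt (Dx i q) := by
    intro i q
    have := D_eq_zero ⁅Dx i, Dt⁆ (fun r => by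
      rw [Derivation.commutator_apply, sub_eq_zero]
      induction r using Polynomial.induction_on' with
      | add p q hp hq => simp only [map_add, hp, hq]
      | monomial m a =>
        rw [hDt, hDx, hDx, hDt, derivative_monomial, Polynomial.sum_monomial_index _ _ (by simp),
          Polynomial.sum_monomial_index _ _ (by simp), C_mul_X_pow_eq_monomial,
          C_mul_X_pow_eq_monomial, derivative_monomial]
        congr 2
        rw [Derivation.leibniz, Derivation.map_natCast]
        simp [mul_comm]) q
    rwa [Derivation.commutator_apply, sub_eq_zero] at this
  have h4 : ∀ i, Commute (dx i) dt := by
    intro i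
    refine LinearMap.ext fun q => ?_
    obtain ⟨q, rfl⟩ := Submodule.Quotient.mk_surjective _ q
    rw [Module.End.mul_apply, Module.End.mul_apply, hdt, hdx, hdx, hdt, hbr]
  have k0 : mulOp K n f (h K n f) (Submodule.Quotient.mk (deltaL K n f)) = 0 := by
    rw [mulOp_mk, h_mul_delta, Submodule.Quotient.mk_eq_zero]
    exact ⟨1, by simp⟩
  have k1 : ∀ i, (dx i + mulOp K n f (C (MvPolynomial.pderiv i f)) * dt)
      (Submodule.Quotient.mk (deltaL K n f)) = 0 := by
    intro i
    rw [LinearMap.add_apply, Module.End.mul_apply, hdx, hdt, mulOp_mk, ← Submodule.Quotient.mk_add,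
      D_delta, D_delta, hh, hht]
    rw [Submodule.Quotient.mk_eq_zero]
    exact ⟨0, by rw [map_zero]; ring⟩
  have k2 : ∀ (Q0 : Module.End K (Coh K n f)) (Q : Fin n → Module.End K (Coh K n f)),
      (Q0 * mulOp K n f (h K n f) + ∑ i : Fin n,
        Q i * (dx i + mulOp K n f (C (MvPolynomial.pderiv i f)) * dt))
        (Submodule.Quotient.mk (deltaL K n f)) = 0 := by
    intro Q0 Q
    rw [LinearMap.add_apply, LinearMap.sum_apply, Module.End.mul_apply, k0, map_zero, zero_add]
    refine Finset.sum_eq_zero fun i _ => ?_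
    rw [Module.End.mul_apply, k1, map_zero]
  constructor
  · intro h0
    obtain ⟨Q0, Q, p, hQ0, hQ, e⟩ := good_all (f := f) h1 h2 h3 h4 hA P hP
    simp only [muHom_eq] at e
    have hT : T (muHom f) dt p (Submodule.Quotient.mk (deltaL K n f)) = 0 := by
      rw [e, LinearMap.add_apply, k2, zero_add] at h0
      exact h0
    have hp0 := T_zero Dt hDt dt hdt p hT
    refine ⟨Q0, Q, hQ0, hQ, ?_⟩
    rw [e, hp0]
    simp [T]
  · rintro ⟨Q0, Q, -, -, rfl⟩
    exact k2 Q0 Q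

end Stmt17
end
end

section
/- Let K be a field of characteristic zero, A = K[x₁,…,xₙ], f ∈ A non-constant, R = A[t], g = t·f − 1, and B = R[g⁻¹]/R the cokernel of R → Localization.Away g. Let ∂_{x_i} and ∂_t be the endomorphisms of B induced by the unique derivations of Localization.Away g extending the partial derivatives of R. Then the smallest K-subspace of B containing the class δ of f/g and stable under multiplication by each x_i, multiplication by t, and the operators ∂_{x_1},…,∂_{x_n}, ∂_t, equals all of B. -/
open Polynomial

set_option synthInstance.maxHeartbeats 4000000
set_option maxHeartbeats 4000000
set_option maxSynthPendingDepth 3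

noncomputable section

namespace Stmt18

variable (K : Type) [Field K] (n : ℕ)

/-- `R = A[t]` where `A = K[x₁,…,xₙ]`. -/
abbrev R := Polynomial (MvPolynomial (Fin n) K)

/-- `g = t·f − 1 ∈ R`. -/
abbrev g (f : MvPolynomial (Fin n) K) : R K n := X * C f - 1

/-- `R[g⁻¹]`. -/
abbrev L (f : MvPolynomial (Fin n) K) := Localization.Away (g K n f)

/-- `B = R[g⁻¹]/R`, realizing `B_{Z|Y} = K[x,t,(tf−1)⁻¹]/K[x,t]`. -/
abbrev B (f : MvPolynomial (Fin n) K) :=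
  L K n f ⧸ LinearMap.range (Algebra.linearMap (R K n) (L K n f))

/-- The element `f/g = f/(tf−1)` of `R[g⁻¹]`. -/
def deltaL (f : MvPolynomial (Fin n) K) : L K n f :=
  Localization.mk (C f) ⟨g K n f, 1, pow_one _⟩

/-- the smallest `K`-subspace of `B = R[g⁻¹]/R` containing the class `δ` of
`f/g` and stable under multiplication by the `x_i`, multiplication by `t`, and the induced
derivations `∂_{x_1},…,∂_{x_n},∂_t`, is all of `B`; i.e. `B_{Z|Y}` is generated by
`δ^{(0,0)}` as a left `D_Y`-module. -/
theorem stmt18 [CharZero K] (hn : 1 ≤ n)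
    (f : MvPolynomial (Fin n) K) (hf : 1 ≤ f.totalDegree)
    (Dx : Fin n → Derivation K (L K n f) (L K n f))
    (hDx : ∀ i (r : R K n),
      Dx i (algebraMap (R K n) (L K n f) r) =
        algebraMap (R K n) (L K n f)
          (r.sum fun m a => C (MvPolynomial.pderiv i a) * X ^ m))
    (Dt : Derivation K (L K n f) (L K n f))
    (hDt : ∀ r : R K n,
      Dt (algebraMap (R K n) (L K n f) r) =
        algebraMap (R K n) (L K n f) (derivative r))
    (dx : Fin n → Module.End K (B K n f))
    (hdx : ∀ i (q : L K n f),
      dx i (Submodule.Quotient.mk q) = Submodule.Quotient.mk (Dx i q))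
    (dt : Module.End K (B K n f))
    (hdt : ∀ q : L K n f,
      dt (Submodule.Quotient.mk q) = Submodule.Quotient.mk (Dt q)) :
    sInf {N : Submodule K (B K n f) |
        (Submodule.Quotient.mk (deltaL K n f) : B K n f) ∈ N ∧
        (∀ i : Fin n, ∀ w ∈ N, (C (MvPolynomial.X i) : R K n) • w ∈ N) ∧
        (∀ w ∈ N, (X : R K n) • w ∈ N) ∧
        (∀ i : Fin n, ∀ w ∈ N, dx i w ∈ N) ∧
        (∀ w ∈ N, dt w ∈ N)} = ⊤ := by
  rw [sInf_eq_top]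
  rintro N ⟨hδ, hxN, htN, -, hdN⟩
  -- `N` is stable under the action of `R`
  have hR : ∀ (r : R K n), ∀ w ∈ N, r • w ∈ N := by
    have hC : ∀ (a : MvPolynomial (Fin n) K), ∀ w ∈ N, (C a : R K n) • w ∈ N := by
      intro a
      induction a using MvPolynomial.induction_on with
      | C c =>
        intro w hw
        have h : (C (MvPolynomial.C c) : R K n) • w = c • w := by
          rw [← algebraMap_smul (R K n) c w]
          rfl
        rw [h]
        exact N.smul_mem c hw
      | add p q hp hq =>
        intro w hw
        rw [C_add, add_smul]
        exact N.add_mem (hp w hw) (hq w hw)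
      | mul_X p i hp =>
        intro w hw
        rw [C_mul, mul_smul]
        exact hp _ (hxN i w hw)
    have hXp : ∀ (m : ℕ), ∀ w ∈ N, (X ^ m : R K n) • w ∈ N := by
      intro m
      induction m with
      | zero => intro w hw; simpa using hw
      | succ m ih =>
        intro w hw
        rw [pow_succ, mul_smul]
        exact ih _ (htN w hw)
    intro r
    induction r using Polynomial.induction_on' with
    | add p q hp hq =>
      intro w hw
      rw [add_smul]
      exact N.add_mem (hp w hw) (hq w hw)
    | monomial m a =>
      intro w hw
      rw [← C_mul_X_pow_eq_monomial, mul_smul]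
      exact hC a _ (hXp m w hw)
  set φ := algebraMap (R K n) (L K n f) with hφ
  obtain ⟨u, hu⟩ : ∃ u : L K n f, φ (g K n f) * u = 1 :=
    ⟨_, IsLocalization.Away.mul_invSelf (g K n f)⟩
  have hg : φ (g K n f) = φ X * φ (C f) - 1 := by
    rw [map_sub, map_mul, map_one]
  have hδu : deltaL K n f = φ (C f) * u := by
    have h1 : deltaL K n f * φ (g K n f) = φ (C f) := by
      rw [deltaL, Localization.mk_eq_mk']
      exact IsLocalization.mk'_spec (L K n f) (C f) _
    calc deltaL K n f = deltaL K n f * (φ (g K n f) * u) := by rw [hu, mul_one]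
      _ = _ := by rw [← mul_assoc, h1]
  have hmkR : ∀ r : R K n, (Submodule.Quotient.mk (φ r) : B K n f) = 0 := by
    intro r
    rw [Submodule.Quotient.mk_eq_zero]
    exact ⟨r, rfl⟩
  have hsm : ∀ (r : R K n) (q : L K n f),
      (Submodule.Quotient.mk (φ r * q) : B K n f) = r • Submodule.Quotient.mk q := by
    intro r q
    rw [← Submodule.Quotient.mk_smul, Algebra.smul_def]
  -- the class of `1/g`
  have hu1 : (Submodule.Quotient.mk u : B K n f) ∈ N := by
    have h := hR X _ hδ
    rw [← hsm, hδu] at h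
    have e : φ X * (φ (C f) * u) = φ 1 + u := by
      rw [map_one]
      linear_combination hu - u * hg
    rw [e, Submodule.Quotient.mk_add, hmkR, zero_add] at h
    exact h
  have hDtg : Dt (φ (g K n f)) = φ (C f) := by
    rw [hDt]
    congr 1
    simp
  have hDtu : Dt u = - (φ (C f) * u ^ 2) := by
    have h := congrArg Dt hu
    rw [Derivation.leibniz, Derivation.map_one_eq_zero, hDtg, smul_eq_mul, smul_eq_mul] at h
    linear_combination u * h - (Dt u) * hu
  have hpow : ∀ k : ℕ, (Submodule.Quotient.mk (u ^ (k + 1)) : B K n f) ∈ N := by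
    intro k
    induction k with
    | zero => simpa using hu1
    | succ k ih =>
      have h := hR X _ (hdN _ ih)
      rw [hdt, ← hsm] at h
      have e : φ X * Dt (u ^ (k + 1)) = (-((k : K) + 1)) • (u ^ (k + 1) + u ^ (k + 1 + 1)) := by
        rw [Derivation.leibniz_pow, hDtu, Algebra.smul_def (-((k : K) + 1))]
        simp only [map_neg, map_add, map_natCast, map_one, smul_eq_mul, nsmul_eq_mul,
          Nat.add_sub_cancel, Nat.cast_add, Nat.cast_one]
        linear_combination ((k : L K n f) + 1) * u ^ (k + 2) * hg
          - ((k : L K n f) + 1) * u ^ (k + 1) * hu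
      have hk : (-((k : K) + 1)) ≠ 0 := neg_ne_zero.mpr (Nat.cast_add_one_ne_zero k)
      rw [e, Submodule.Quotient.mk_smul, Submodule.Quotient.mk_add] at h
      have h2 := (N.smul_mem_iff hk).mp h
      exact (N.add_mem_iff_right ih).mp h2
  rw [eq_top_iff]
  rintro w -
  obtain ⟨q, rfl⟩ := Submodule.Quotient.mk_surjective _ w
  obtain ⟨k, r, hr⟩ := IsLocalization.Away.surj (g K n f) q
  have hq : q = φ r * u ^ k := by
    have h1 : φ (g K n f) ^ k * u ^ k = 1 := by rw [← mul_pow, hu, one_pow]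
    linear_combination u ^ k * hr - q * h1
  rw [hq, hsm]
  rcases k with _ | k
  · rw [← hsm, pow_zero, mul_one, hmkR]
    exact N.zero_mem
  · exact hR r _ (hpow k)

end Stmt18
end
end

section
/- Let K be a field of characteristic zero, A = K[x₁,…,xₙ], f ∈ A non-constant, V = Localization.Away f, W = V[s] with twisted derivations ∂̃_i(a·s^m) = (∂_i a)·s^m + (f_i/f)·a·s^{m+1}, 𝒟_s ⊆ End_K(W) the K-subalgebra generated by multiplication by x₁,…,xₙ, multiplication by s, and the ∂̃_i, N ⊆ W the smallest K-subspace containing 1 and stable under all operators of 𝒟_s, and I(f) = {b ∈ K[s] : ∃ P ∈ 𝒟_s, P(f·1) = b(s)·1}. Let T : W → W be the K-linear map T(p) = f·(p ∘ (s+1)) (multiply by f after substituting s ↦ s+1), which models the shift operator t. Then T maps N into N and maps (s−λ−1)·N into (s−λ)·N for each λ ∈ K, hence induces a K-linear map φ_λ : N/(s−λ−1)N → N/(s−λ)N; and if b is a nonzero element of minimal degree of I(f), then φ_λ is bijective if and only if b(λ) ≠ 0. -/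
open Polynomial

set_option synthInstance.maxHeartbeats 4000000
set_option maxHeartbeats 4000000
set_option maxSynthPendingDepth 3

noncomputable section

namespace Stmt19

variable (K : Type) [Field K] (n : ℕ)

/-- `V = K[x,f⁻¹]`. -/
abbrev V (f : MvPolynomial (Fin n) K) := Localization.Away f

/-- `W = V[s]`, realizing `K[x,f⁻¹,s]·f^s` (with `f^s ↔ 1`). -/
abbrev W (f : MvPolynomial (Fin n) K) := Polynomial (V K n f)

/-- `f_i/f ∈ V`. -/
def c (f : MvPolynomial (Fin n) K) (i : Fin n) : V K n f :=
  algebraMap (MvPolynomial (Fin n) K) (V K n f) (MvPolynomial.pderiv i f) *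
    Ring.inverse (algebraMap (MvPolynomial (Fin n) K) (V K n f) f)

/-- `𝒟_s ⊆ End_K(W)`: the `K`-subalgebra generated by multiplication by `x₁,…,xₙ`,
multiplication by `s`, and the twisted derivations `∂̃_i`; it models `D_X[s]`. -/
def Ds (f : MvPolynomial (Fin n) K) (Dtil : Fin n → Module.End K (W K n f)) :
    Subalgebra K (Module.End K (W K n f)) :=
  Algebra.adjoin K
    (((Set.range fun i : Fin n =>
          (LinearMap.mulLeft K
            (C (algebraMap (MvPolynomial (Fin n) K) (V K n f) (MvPolynomial.X i)) : W K n f)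
            : Module.End K (W K n f))) ∪
        {(LinearMap.mulLeft K (X : W K n f) : Module.End K (W K n f))}) ∪
      Set.range Dtil)

/-- `N = D_X[s]·f^s ⊆ W`: the smallest `K`-subspace of `W` containing `1` and stable
under all operators of `𝒟_s`; it realizes `M(u,f,s) = D_X[s](u ⊗ f^s)` for `M = K[x]`. -/
def NN (f : MvPolynomial (Fin n) K) (Dtil : Fin n → Module.End K (W K n f)) :
    Submodule K (W K n f) :=
  sInf {N : Submodule K (W K n f) |
    (1 : W K n f) ∈ N ∧ ∀ P ∈ Ds K n f Dtil, ∀ w ∈ N, P w ∈ N}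


/-- The shift operator `T : W → W`, `T(p) = f·p(s+1)`, modeling the operator `t` on
`K[x,f⁻¹,s]f^s` (`t(a(x,s)f^{s-k}) = a(x,s+1)f^{s-k+1}`). -/
def T (f : MvPolynomial (Fin n) K) : W K n f →ₗ[K] W K n f where
  toFun p := C (algebraMap (MvPolynomial (Fin n) K) (V K n f) f) * p.comp (X + 1)
  map_add' p q := by simp [add_comp, mul_add]
  map_smul' k p := by simp [smul_comp, mul_smul_comm]


section helpers

variable {K n}
variable {f : MvPolynomial (Fin n) K} {Dtil : Fin n → Module.End K (W K n f)}

/-- Stability under the generators of `𝒟_s`. -/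
def Stab (Dtil : Fin n → Module.End K (W K n f)) (N : Submodule K (W K n f)) : Prop :=
  (∀ i : Fin n, ∀ w ∈ N,
    C (algebraMap (MvPolynomial (Fin n) K) (V K n f) (MvPolynomial.X i)) * w ∈ N) ∧
  (∀ w ∈ N, X * w ∈ N) ∧ (∀ i : Fin n, ∀ w ∈ N, Dtil i w ∈ N)

lemma Stab.all {N : Submodule K (W K n f)} (h : Stab Dtil N)
    {P : Module.End K (W K n f)} (hP : P ∈ Ds K n f Dtil) :
    ∀ w ∈ N, P w ∈ N := by
  unfold Ds at hP
  induction hP using Algebra.adjoin_induction with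
  | mem x hx =>
    rcases hx with (⟨i, rfl⟩ | hx) | ⟨i, rfl⟩
    · intro w hw
      exact h.1 i w hw
    · rw [Set.mem_singleton_iff] at hx
      subst hx
      intro w hw
      exact h.2.1 w hw
    · exact h.2.2 i
  | algebraMap r =>
    intro w hw
    exact N.smul_mem r hw
  | add x y _ _ hx hy =>
    intro w hw
    exact N.add_mem (hx w hw) (hy w hw)
  | mul x y _ _ hx hy =>
    intro w hw
    exact hx _ (hy w hw)

lemma NN_le {N : Submodule K (W K n f)} (h1 : (1 : W K n f) ∈ N) (h : Stab Dtil N) :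
    NN K n f Dtil ≤ N :=
  sInf_le ⟨h1, fun _ hP => h.all hP⟩

lemma one_mem_NN : (1 : W K n f) ∈ NN K n f Dtil := by
  unfold NN
  rw [Submodule.mem_sInf]
  exact fun N hN => hN.1

lemma Ds_NN {P : Module.End K (W K n f)} (hP : P ∈ Ds K n f Dtil) {w : W K n f}
    (hw : w ∈ NN K n f Dtil) : P w ∈ NN K n f Dtil := by
  unfold NN at hw ⊢
  rw [Submodule.mem_sInf] at hw ⊢
  exact fun N hN => hN.2 P hP w (hw N hN)

lemma x_mem (i : Fin n) : (LinearMap.mulLeft K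
    (C (algebraMap (MvPolynomial (Fin n) K) (V K n f) (MvPolynomial.X i)) : W K n f)
      : Module.End K (W K n f)) ∈ Ds K n f Dtil :=
  Algebra.subset_adjoin (Or.inl (Or.inl ⟨i, rfl⟩))

lemma s_mem : (LinearMap.mulLeft K (X : W K n f) : Module.End K (W K n f)) ∈ Ds K n f Dtil :=
  Algebra.subset_adjoin (Or.inl (Or.inr rfl))

lemma d_mem (i : Fin n) : Dtil i ∈ Ds K n f Dtil :=
  Algebra.subset_adjoin (Or.inr ⟨i, rfl⟩)

lemma stab_NN : Stab Dtil (NN K n f Dtil) :=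
  ⟨fun i _ hw => Ds_NN (x_mem i) hw, fun _ hw => Ds_NN s_mem hw, fun i _ hw => Ds_NN (d_mem i) hw⟩

lemma C_smul (k : K) (w : W K n f) : C (algebraMap K (V K n f) k) * w = k • w := by
  rw [Algebra.smul_def]
  rfl

/-- Stable subspaces are stable under multiplication by `K[s]`. -/
lemma Stab.poly {N : Submodule K (W K n f)} (h : Stab Dtil N) (p : Polynomial K) :
    ∀ w ∈ N, p.map (algebraMap K (V K n f)) * w ∈ N := by
  induction p using Polynomial.induction_on' with
  | add p q hp hq =>
    intro w hw
    rw [Polynomial.map_add, add_mul]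
    exact N.add_mem (hp w hw) (hq w hw)
  | monomial m a =>
    intro w hw
    rw [← C_mul_X_pow_eq_monomial, Polynomial.map_mul, Polynomial.map_C, Polynomial.map_pow,
      Polynomial.map_X, mul_assoc, C_smul]
    apply N.smul_mem
    induction m with
    | zero => simpa using hw
    | succ m ih =>
      rw [pow_succ', mul_assoc]
      exact h.2.1 _ ih

/-- Stable subspaces are stable under multiplication by `K[x]`. -/
lemma Stab.mv {N : Submodule K (W K n f)} (h : Stab Dtil N) (a : MvPolynomial (Fin n) K) :
    ∀ w ∈ N, C (algebraMap (MvPolynomial (Fin n) K) (V K n f) a) * w ∈ N := by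
  induction a using MvPolynomial.induction_on with
  | C k =>
    intro w hw
    have : algebraMap (MvPolynomial (Fin n) K) (V K n f) (MvPolynomial.C k)
        = algebraMap K (V K n f) k := by
      rw [IsScalarTower.algebraMap_apply K (MvPolynomial (Fin n) K) (V K n f)]
      rfl
    rw [this, C_smul]
    exact N.smul_mem k hw
  | add p q hp hq =>
    intro w hw
    rw [map_add, C_add, add_mul]
    exact N.add_mem (hp w hw) (hq w hw)
  | mul_X p i hp =>
    intro w hw
    rw [map_mul, C_mul, mul_assoc]
    exact hp _ (h.1 i w hw)

lemma fmap_unit : IsUnit (algebraMap (MvPolynomial (Fin n) K) (V K n f) f) :=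
  IsLocalization.Away.algebraMap_isUnit f

lemma T_apply (p : W K n f) : T K n f p =
    C (algebraMap (MvPolynomial (Fin n) K) (V K n f) f) * p.comp (X + 1) := rfl

lemma T_inj {p q : W K n f} (h : T K n f p = T K n f q) : p = q := by
  rw [T_apply, T_apply] at h
  have h2 := (fmap_unit.map (C : V K n f →+* W K n f)).mul_left_cancel h
  have h3 := congrArg (fun r : W K n f => r.comp (X - 1)) h2
  simpa [comp_assoc] using h3

lemma T_mul (p q : W K n f) : T K n f (p * q) = p.comp (X + 1) * T K n f q := by
  rw [T_apply, T_apply, mul_comp]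
  ring

lemma T_lin (lam : K) (v : W K n f) :
    T K n f ((X - C (algebraMap K (V K n f) (lam + 1))) * v) =
      (X - C (algebraMap K (V K n f) lam)) * T K n f v := by
  rw [T_mul]
  congr 1
  simp

variable {Dx : Fin n → Derivation K (V K n f) (V K n f)}

lemma D_X_mul
    (hDtil : ∀ i (a : V K n f) (m : ℕ),
      Dtil i (C a * X ^ m) = C (Dx i a) * X ^ m + C (c K n f i * a) * X ^ (m + 1))
    (i : Fin n) (w : W K n f) : Dtil i (X * w) = X * Dtil i w := by
  induction w using Polynomial.induction_on' with
  | add p q hp hq => rw [mul_add, map_add, hp, hq, map_add, mul_add]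
  | monomial m a =>
    rw [← C_mul_X_pow_eq_monomial, hDtil,
      show (X : W K n f) * (C a * X ^ m) = C a * X ^ (m + 1) by ring, hDtil]
    ring

lemma D_poly_mul
    (hDtil : ∀ i (a : V K n f) (m : ℕ),
      Dtil i (C a * X ^ m) = C (Dx i a) * X ^ m + C (c K n f i * a) * X ^ (m + 1))
    (p : Polynomial K) (i : Fin n) (w : W K n f) :
    Dtil i (p.map (algebraMap K (V K n f)) * w) =
      p.map (algebraMap K (V K n f)) * Dtil i w := by
  induction p using Polynomial.induction_on' with
  | add p q hp hq => rw [Polynomial.map_add, add_mul, map_add, hp, hq, add_mul]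
  | monomial m a =>
    rw [← C_mul_X_pow_eq_monomial, Polynomial.map_mul, Polynomial.map_C, Polynomial.map_pow,
      Polynomial.map_X, mul_assoc, mul_assoc, C_smul, C_smul, map_smul]
    congr 1
    induction m with
    | zero => simp
    | succ m ih => rw [pow_succ', mul_assoc, D_X_mul hDtil, ih, mul_assoc]

lemma c_mul (i : Fin n) : c K n f i * algebraMap (MvPolynomial (Fin n) K) (V K n f) f =
    algebraMap (MvPolynomial (Fin n) K) (V K n f) (MvPolynomial.pderiv i f) := by
  unfold c
  rw [mul_assoc, Ring.inverse_mul_cancel _ fmap_unit, mul_one]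

lemma D_T
    (hDx : ∀ i (a : MvPolynomial (Fin n) K),
      Dx i (algebraMap (MvPolynomial (Fin n) K) (V K n f) a) =
        algebraMap (MvPolynomial (Fin n) K) (V K n f) (MvPolynomial.pderiv i a))
    (hDtil : ∀ i (a : V K n f) (m : ℕ),
      Dtil i (C a * X ^ m) = C (Dx i a) * X ^ m + C (c K n f i * a) * X ^ (m + 1))
    (i : Fin n) (w : W K n f) : Dtil i (T K n f w) = T K n f (Dtil i w) := by
  induction w using Polynomial.induction_on' with
  | add p q hp hq => simp only [map_add, hp, hq]
  | monomial m a =>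
    have e : (((X + 1 : Polynomial K) ^ m).map (algebraMap K (V K n f))) = (X + 1) ^ m := by simp
    have h0 := hDtil i (algebraMap (MvPolynomial (Fin n) K) (V K n f) f * a) 0
    have h1 : T K n f (C a * X ^ m) = ((X + 1 : Polynomial K) ^ m).map (algebraMap K (V K n f)) *
        (C (algebraMap (MvPolynomial (Fin n) K) (V K n f) f * a) * X ^ 0) := by
      rw [e, T_apply]
      simp only [mul_comp, C_comp, X_pow_comp, C_mul]
      ring
    rw [← C_mul_X_pow_eq_monomial, h1, D_poly_mul hDtil, h0, hDtil, e, T_apply, Derivation.leibniz,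
      hDx, ← c_mul]
    simp only [add_comp, mul_comp, C_comp, X_pow_comp, C_mul, C_add, smul_eq_mul]
    ring

lemma stab_map_T
    (hDx : ∀ i (a : MvPolynomial (Fin n) K),
      Dx i (algebraMap (MvPolynomial (Fin n) K) (V K n f) a) =
        algebraMap (MvPolynomial (Fin n) K) (V K n f) (MvPolynomial.pderiv i a))
    (hDtil : ∀ i (a : V K n f) (m : ℕ),
      Dtil i (C a * X ^ m) = C (Dx i a) * X ^ m + C (c K n f i * a) * X ^ (m + 1)) :
    Stab Dtil ((NN K n f Dtil).map (T K n f)) := by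
  refine ⟨?_, ?_, ?_⟩
  · rintro i _ ⟨v, hv, rfl⟩
    refine ⟨_, stab_NN.1 i v hv, ?_⟩
    rw [T_mul, C_comp]
  · rintro _ ⟨v, hv, rfl⟩
    refine ⟨X * v - v, Submodule.sub_mem _ (stab_NN.2.1 v hv) hv, ?_⟩
    rw [map_sub, T_mul, X_comp]
    ring
  · rintro i _ ⟨v, hv, rfl⟩
    exact ⟨_, stab_NN.2.2 i v hv, (D_T hDx hDtil i v).symm⟩

lemma f_mem_NN : (C (algebraMap (MvPolynomial (Fin n) K) (V K n f) f) : W K n f) ∈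
    NN K n f Dtil := by
  simpa using stab_NN.mv f 1 one_mem_NN

lemma T_one : T K n f 1 = C (algebraMap (MvPolynomial (Fin n) K) (V K n f) f) := by
  rw [T_apply]
  simp

/-- `𝒟_s · f` as a subspace. -/
def DsF (f : MvPolynomial (Fin n) K) (Dtil : Fin n → Module.End K (W K n f)) :
    Submodule K (W K n f) :=
  (Subalgebra.toSubmodule (Ds K n f Dtil)).map
    (LinearMap.applyₗ (C (algebraMap (MvPolynomial (Fin n) K) (V K n f) f) : W K n f))

lemma mem_DsF {w : W K n f} : w ∈ DsF f Dtil ↔ ∃ P ∈ Ds K n f Dtil,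
    P (C (algebraMap (MvPolynomial (Fin n) K) (V K n f) f)) = w := Iff.rfl

lemma stab_DsF : Stab Dtil (DsF f Dtil) := by
  refine ⟨?_, ?_, ?_⟩
  · rintro i _ ⟨P, hP, rfl⟩
    exact ⟨_, (Ds K n f Dtil).mul_mem (x_mem i) hP, rfl⟩
  · rintro _ ⟨P, hP, rfl⟩
    exact ⟨_, (Ds K n f Dtil).mul_mem s_mem hP, rfl⟩
  · rintro i _ ⟨P, hP, rfl⟩
    exact ⟨_, (Ds K n f Dtil).mul_mem (d_mem i) hP, rfl⟩

lemma T_mem_DsF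
    (hDx : ∀ i (a : MvPolynomial (Fin n) K),
      Dx i (algebraMap (MvPolynomial (Fin n) K) (V K n f) a) =
        algebraMap (MvPolynomial (Fin n) K) (V K n f) (MvPolynomial.pderiv i a))
    (hDtil : ∀ i (a : V K n f) (m : ℕ),
      Dtil i (C a * X ^ m) = C (Dx i a) * X ^ m + C (c K n f i * a) * X ^ (m + 1))
    {v : W K n f} (hv : v ∈ NN K n f Dtil) : T K n f v ∈ DsF f Dtil := by
  have : NN K n f Dtil ≤ (DsF f Dtil).comap (T K n f) := by
    apply NN_le
    · rw [Submodule.mem_comap, T_one]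
      exact ⟨1, (Ds K n f Dtil).one_mem, rfl⟩
    · refine ⟨?_, ?_, ?_⟩
      · intro i w hw
        rw [Submodule.mem_comap, T_mul, C_comp]
        exact stab_DsF.1 i _ hw
      · intro w hw
        rw [Submodule.mem_comap, T_mul, X_comp, add_mul, one_mul]
        exact Submodule.add_mem _ (stab_DsF.2.1 _ hw) hw
      · intro i w hw
        rw [Submodule.mem_comap, ← D_T hDx hDtil]
        exact stab_DsF.2.2 i _ hw
  exact this hv

lemma poly_NN
    (hDx : ∀ i (a : MvPolynomial (Fin n) K),
      Dx i (algebraMap (MvPolynomial (Fin n) K) (V K n f) a) =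
        algebraMap (MvPolynomial (Fin n) K) (V K n f) (MvPolynomial.pderiv i a))
    (hDtil : ∀ i (a : V K n f) (m : ℕ),
      Dtil i (C a * X ^ m) = C (Dx i a) * X ^ m + C (c K n f i * a) * X ^ (m + 1))
    (b : Polynomial K) (hbI : ∃ P ∈ Ds K n f Dtil,
      P (C (algebraMap (MvPolynomial (Fin n) K) (V K n f) f)) =
        b.map (algebraMap K (V K n f))) {v : W K n f} (hv : v ∈ NN K n f Dtil) :
    ∃ w ∈ NN K n f Dtil, T K n f w = b.map (algebraMap K (V K n f)) * v := by
  have hs := stab_map_T hDx hDtil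
  have : NN K n f Dtil ≤ ((NN K n f Dtil).map (T K n f)).comap
      (LinearMap.mulLeft K (b.map (algebraMap K (V K n f)))) := by
    apply NN_le
    · rw [Submodule.mem_comap, LinearMap.mulLeft_apply, mul_one]
      obtain ⟨P, hP, h⟩ := hbI
      rw [← h]
      exact hs.all hP _ ⟨1, one_mem_NN, T_one⟩
    · refine ⟨?_, ?_, ?_⟩
      · intro i w hw
        rw [Submodule.mem_comap, LinearMap.mulLeft_apply, mul_left_comm]
        exact hs.1 i _ hw
      · intro w hw
        rw [Submodule.mem_comap, LinearMap.mulLeft_apply, mul_left_comm]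
        exact hs.2.1 _ hw
      · intro i w hw
        rw [Submodule.mem_comap, LinearMap.mulLeft_apply, ← D_poly_mul hDtil]
        exact hs.2.2 i _ hw
  exact this hv

end helpers

/-- with `N = D_X[s]·f^s ⊆ W` and `T(p) = f·p(s+1)` the shift operator:
`T` maps `N` into `N`, maps `(s−λ−1)·N` into `(s−λ)·N` (hence induces
`φ_λ : N/(s−λ−1)N → N/(s−λ)N`), and if `b` is a nonzero element of minimal degree of
`I(f) = {b : ∃ P ∈ 𝒟_s, P(f·1) = b(s)·1}` then `φ_λ` is bijective iff `b(λ) ≠ 0`. -/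
theorem stmt19 [CharZero K] (hn : 1 ≤ n)
    (f : MvPolynomial (Fin n) K) (hf : 1 ≤ f.totalDegree)
    (Dx : Fin n → Derivation K (V K n f) (V K n f))
    (hDx : ∀ i (a : MvPolynomial (Fin n) K),
      Dx i (algebraMap (MvPolynomial (Fin n) K) (V K n f) a) =
        algebraMap (MvPolynomial (Fin n) K) (V K n f) (MvPolynomial.pderiv i a))
    (Dtil : Fin n → Module.End K (W K n f))
    (hDtil : ∀ i (a : V K n f) (m : ℕ),
      Dtil i (C a * X ^ m) = C (Dx i a) * X ^ m + C (c K n f i * a) * X ^ (m + 1))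
    (b : Polynomial K) (hb : b ≠ 0)
    (hbI : ∃ P ∈ Ds K n f Dtil,
      P (C (algebraMap (MvPolynomial (Fin n) K) (V K n f) f)) =
        b.map (algebraMap K (V K n f)))
    (hbmin : ∀ b' : Polynomial K, b' ≠ 0 →
      (∃ P ∈ Ds K n f Dtil,
        P (C (algebraMap (MvPolynomial (Fin n) K) (V K n f) f)) =
          b'.map (algebraMap K (V K n f))) →
      b.degree ≤ b'.degree) :
    -- (a) `T` maps `N` into `N`
    (∀ v ∈ NN K n f Dtil, T K n f v ∈ NN K n f Dtil) ∧
    -- (b) `T` maps `(s−λ−1)·N` into `(s−λ)·N`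
    (∀ lam : K, ∀ v ∈ NN K n f Dtil,
      ∃ w ∈ NN K n f Dtil,
        T K n f ((X - C (algebraMap K (V K n f) (lam + 1))) * v) =
          (X - C (algebraMap K (V K n f) lam)) * w) ∧
    -- (c) the induced map `φ_λ : N/(s−λ−1)N → N/(s−λ)N` is bijective iff `b(λ) ≠ 0`
    (∀ lam : K,
      (b.eval lam ≠ 0 ↔
        -- surjectivity of `φ_λ`
        ((∀ w ∈ NN K n f Dtil, ∃ v ∈ NN K n f Dtil, ∃ u ∈ NN K n f Dtil,
            w = T K n f v + (X - C (algebraMap K (V K n f) lam)) * u) ∧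
          -- injectivity of `φ_λ`
          (∀ v ∈ NN K n f Dtil,
            (∃ u ∈ NN K n f Dtil,
              T K n f v = (X - C (algebraMap K (V K n f) lam)) * u) →
            ∃ u' ∈ NN K n f Dtil,
              v = (X - C (algebraMap K (V K n f) (lam + 1))) * u')))) := by
  have hN := stab_NN (Dtil := Dtil)
  have hTN : ∀ v ∈ NN K n f Dtil, T K n f v ∈ NN K n f Dtil := by
    intro v hv
    obtain ⟨P, hP, h⟩ := T_mem_DsF hDx hDtil hv
    rw [← h]
    exact Ds_NN hP f_mem_NN
  refine ⟨hTN, fun lam v hv => ⟨_, hTN v hv, T_lin lam v⟩, ?_⟩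
  intro lam
  have hbN := fun {v} => poly_NN hDx hDtil b hbI (v := v)
  constructor
  · intro hlam
    obtain ⟨q, hq⟩ : (X - C lam) ∣ b - C (b.eval lam) := by
      rw [dvd_iff_isRoot]
      simp
    have hq' : b.map (algebraMap K (V K n f)) = C (algebraMap K (V K n f) (b.eval lam)) +
        (X - C (algebraMap K (V K n f) lam)) * q.map (algebraMap K (V K n f)) := by
      have := congrArg (Polynomial.map (algebraMap K (V K n f))) (sub_eq_iff_eq_add'.mp hq)
      simpa using this
    constructor
    · intro w hw
      obtain ⟨v, hv, hvw⟩ := hbN hw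
      refine ⟨(b.eval lam)⁻¹ • v, Submodule.smul_mem _ _ hv,
        -((b.eval lam)⁻¹ • (q.map (algebraMap K (V K n f)) * w)),
        Submodule.neg_mem _ (Submodule.smul_mem _ _ (hN.poly q w hw)), ?_⟩
      rw [map_smul, hvw, hq', add_mul, C_smul, smul_add, smul_smul, inv_mul_cancel₀ hlam, one_smul,
        mul_neg, mul_smul_comm, mul_assoc]
      abel
    · rintro v hv ⟨u, hu, huv⟩
      obtain ⟨w, hw, hwu⟩ := hbN hu
      have hq1 : (q.comp (X - 1)).map (algebraMap K (V K n f)) =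
        (q.map (algebraMap K (V K n f))).comp (X - 1) := by
        simp [Polynomial.map_comp]
      refine ⟨(b.eval lam)⁻¹ • (w - (q.comp (X - 1)).map (algebraMap K (V K n f)) * v),
        Submodule.smul_mem _ _ (Submodule.sub_mem _ hw (hN.poly _ v hv)), ?_⟩
      rw [mul_smul_comm, eq_inv_smul_iff₀ hlam]
      apply T_inj
      rw [T_lin, map_sub, hwu, T_mul, map_smul, hq1, comp_assoc]
      have e : ((X : W K n f) - 1).comp (X + 1) = X := by simp
      rw [e, comp_X, mul_sub, ← C_smul]
      have h3 : (X - C (algebraMap K (V K n f) lam)) * (b.map (algebraMap K (V K n f)) * u)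
          = b.map (algebraMap K (V K n f)) * T K n f v := by
        rw [huv]
        ring
      rw [h3, hq']
      ring
  · rintro ⟨hsurj, -⟩ hlam
    obtain ⟨q, hq⟩ : (X - C lam) ∣ b := dvd_iff_isRoot.mpr hlam
    have hq0 : q ≠ 0 := by
      rintro rfl
      exact hb (by simpa using hq)
    obtain ⟨v, hv, u, hu, h1⟩ := hsurj 1 one_mem_NN
    have hle := hbmin q hq0 (by
      obtain ⟨w, hw, hwu⟩ := hbN hu
      have h2 : q.map (algebraMap K (V K n f)) =
          q.map (algebraMap K (V K n f)) * T K n f v + T K n f w := by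
        rw [hwu]
        conv_lhs => rw [← mul_one (q.map (algebraMap K (V K n f))), h1]
        rw [hq]
        simp only [Polynomial.map_mul, Polynomial.map_sub, Polynomial.map_X, Polynomial.map_C]
        ring
      have h3 : q.map (algebraMap K (V K n f)) ∈ DsF f Dtil := by
        rw [h2]
        exact Submodule.add_mem _ (stab_DsF.poly q _ (T_mem_DsF hDx hDtil hv))
          (T_mem_DsF hDx hDtil hw)
      exact mem_DsF.mp h3)
    rw [hq, degree_mul, degree_X_sub_C, degree_eq_natDegree hq0] at hle
    have : 1 + q.natDegree ≤ q.natDegree := by exact_mod_cast hle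
    omega

end Stmt19
end
end
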